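/- arXiv:2604.25151 — 2 statements merged into one kernel-verified Lean document; each statement's English description precedes it below -/
import Mathlib

section
/- Let γ = (γ_n)_{n≥1} be a complex sequence and define b_n := ∑_{d∣n} γ_d for n ≥ 1. If both γ and b = (b_n)_{n≥1} are eventually linearly recurrent, then γ is finitely supported, i.e., γ_n = 0 for all sufficiently large n. -/
/-- A complex sequence `u` is *eventually linearly recurrent* if there exist `r ≥ 1`,
coefficients `c 0, …, c (r-1)` with trailing coefficient `c 0 ≠ 0` (the coefficient of
`u n` in the recurrence), and an index `N` such that
`u (n + r) = ∑ i < r, c i * u (n + i)` for all `n ≥ N`. -/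
def EventuallyLinRec (u : ℕ → ℂ) : Prop :=
  ∃ (r : ℕ) (c : ℕ → ℂ) (N : ℕ), 1 ≤ r ∧ c 0 ≠ 0 ∧
    ∀ n, N ≤ n → u (n + r) = ∑ i ∈ Finset.range r, c i * u (n + i)

theorem int_jac : IsJacobsonRing ℤ := by
  rw [isJacobsonRing_iff_prime_eq]
  intro P hP
  by_cases h : P = ⊥
  · subst h
    rw [eq_bot_iff]
    intro x hx
    rw [Ideal.mem_jacobson_bot] at hx
    have h1 := hx x
    rw [Int.isUnit_iff] at h1
    have : x * x = 0 := by
      rcases h1 with h1 | h1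
      · linarith
      · nlinarith [mul_self_nonneg x]
    simpa using this
  · have := hP.isMaximal h
    exact Ideal.jacobson_eq_self_of_isMaximal

theorem finite_of_ft (A F : Type) [CommRing A] [Algebra ℤ A] [Algebra.FiniteType ℤ A]
    [Field F] (f : A →+* F) (hf : Function.Surjective f) : Finite F := by
  have : Algebra.FiniteType ℤ F := Algebra.FiniteType.of_surjective (A := A)
    { f with commutes' := fun n => by simp } hf
  have := int_jac
  have hfin : Module.Finite ℤ F := finite_of_finite_type_of_isJacobsonRing ℤ F
  have hint : Algebra.IsIntegral ℤ F := inferInstance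
  have hninj : ¬ Function.Injective (algebraMap ℤ F) := fun h =>
    Int.not_isField (isField_of_isIntegral_of_isField h (Field.toIsField F))
  rw [injective_iff_map_eq_zero] at hninj
  push Not at hninj
  obtain ⟨a, ha, ha0⟩ := hninj
  apply Module.finite_of_fg_torsion
  intro x
  refine ⟨⟨a, mem_nonZeroDivisors_of_ne_zero ha0⟩, ?_⟩
  change a • x = 0
  rw [Algebra.smul_def, ha, zero_mul]

theorem per_fwd {F : Type} [Field F] [Finite F] (u : ℕ → F) (r N : ℕ) (d : ℕ → F)
    (h : ∀ n, N ≤ n → u (n + r) = ∑ i ∈ Finset.range r, d i * u (n + i)) :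
    ∃ T N', 1 ≤ T ∧ ∀ n, N' ≤ n → u (n + T) = u n := by
  obtain ⟨x, y, hne, heq⟩ := Finite.exists_ne_map_eq_of_infinite
    (fun n : ℕ => fun i : Fin r => u (N + n + i))
  wlog hxy : x < y generalizing x y
  · exact this y x hne.symm heq.symm (by omega)
  refine ⟨y - x, N + x, by omega, ?_⟩
  have key : ∀ j, u (N + y + j) = u (N + x + j) := by
    intro j
    induction j using Nat.strong_induction_on with
    | _ j ih =>
      by_cases hj : j < r
      · exact (congrFun heq ⟨j, hj⟩).symm
      · have e1 : N + y + j = (N + y + (j - r)) + r := by omega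
        have e2 : N + x + j = (N + x + (j - r)) + r := by omega
        rw [e1, e2, h _ (by omega), h _ (by omega)]
        apply Finset.sum_congr rfl
        intro i hi
        have := Finset.mem_range.mp hi
        rw [add_assoc (N + y), add_assoc (N + x), ih _ (by omega)]
  intro n hn
  have := key (n - (N + x))
  rw [show N + y + (n - (N + x)) = n + (y - x) by omega,
    show N + x + (n - (N + x)) = n by omega] at this
  exact this

theorem per_pure {F : Type} [Field F] (u : ℕ → F) (r N : ℕ) (d : ℕ → F) (hr : 1 ≤ r)
    (hd : d 0 ≠ 0)
    (h : ∀ n, N ≤ n → u (n + r) = ∑ i ∈ Finset.range r, d i * u (n + i))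
    (T N' : ℕ) (hT : ∀ n, N' ≤ n → u (n + T) = u n) :
    ∀ n, N ≤ n → u (n + T) = u n := by
  have key : ∀ k n, N ≤ n → N' ≤ n + k → u (n + T) = u n := by
    intro k
    induction k with
    | zero => intro n _ hn; exact hT n hn
    | succ k ih =>
      intro n hn hk
      obtain ⟨s, rfl⟩ : ∃ s, r = s + 1 := ⟨r - 1, by omega⟩
      have ih' : ∀ m, n < m → u (m + T) = u m := fun m hm => ih m (by omega) (by omega)
      have h1 := h n hn
      have h2 := h (n + T) (by omega)
      rw [Finset.sum_range_succ'] at h1 h2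
      have e1 : u (n + T + (s + 1)) = u (n + (s + 1)) := by
        rw [← ih' (n + (s + 1)) (by omega)]; congr 1; omega
      have e2 : ∑ i ∈ Finset.range s, d (i + 1) * u (n + T + (i + 1))
          = ∑ i ∈ Finset.range s, d (i + 1) * u (n + (i + 1)) := by
        apply Finset.sum_congr rfl
        intro i _
        rw [← ih' (n + (i + 1)) (by omega)]; congr 2; omega
      rw [e1, e2, h1] at h2
      have h3 := add_left_cancel h2
      simpa using (mul_left_cancel₀ hd h3).symm
  intro n hn
  exact key N' n hn (by omega)

theorem per_mod {F : Type} (u : ℕ → F) (T N : ℕ) (hT : ∀ n, N ≤ n → u (n + T) = u n)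
    (m n : ℕ) (hm : N ≤ m) (hn : N ≤ n) (h : m ≡ n [MOD T]) : u m = u n := by
  have step : ∀ j m, N ≤ m → u (m + T * j) = u m := by
    intro j
    induction j with
    | zero => simp
    | succ j ih =>
      intro m hm
      rw [mul_add, mul_one, ← add_assoc, hT _ (by omega), ih m hm]
  wlog hmn : m ≤ n generalizing m n
  · exact (this n m hn hm h.symm (by omega)).symm
  obtain ⟨j, hj⟩ := (Nat.modEq_iff_dvd' hmn).mp h
  rw [show n = m + T * j by omega, step j m hm]

theorem split {F : Type} [Field F] (f : ℕ → F) (k p : ℕ) (hp : p.Prime) (hk : 1 ≤ k)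
    (hkp : ¬ p ∣ k) :
    ∑ d ∈ (k * p).divisors, f d = ∑ d ∈ k.divisors, f d + ∑ d ∈ k.divisors, f (d * p) := by
  classical
  have hdis : Disjoint k.divisors (k.divisors.image (· * p)) := by
    rw [Finset.disjoint_left]
    intro x hx hx'
    obtain ⟨y, _, rfl⟩ := Finset.mem_image.mp hx'
    exact hkp ((Dvd.intro_left y rfl).trans (Nat.dvd_of_mem_divisors hx))
  have hun : (k * p).divisors = k.divisors ∪ k.divisors.image (· * p) := by
    rw [Nat.divisors_mul, hp.divisors]
    ext x
    simp only [Finset.mem_mul, Finset.mem_union, Finset.mem_image, Finset.mem_insert,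
      Finset.mem_singleton]
    constructor
    · rintro ⟨y, hy, z, rfl | rfl, rfl⟩
      · left; simpa using hy
      · right; exact ⟨y, hy, rfl⟩
    · rintro (h | ⟨y, hy, rfl⟩)
      · exact ⟨x, h, 1, Or.inl rfl, by simp⟩
      · exact ⟨y, hy, p, Or.inr rfl, rfl⟩
  rw [hun, Finset.sum_union hdis, Finset.sum_image]
  intro a _ b _ hab
  exact Nat.eq_of_mul_eq_mul_right hp.pos hab

theorem core {F : Type} [Field F] (g B : ℕ → F)
    (hB : ∀ n, 1 ≤ n → B n = ∑ d ∈ n.divisors, g d) (T N N' : ℕ) (hT : 1 ≤ T)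
    (hg : ∀ n, N ≤ n → g (n + T) = g n) (hb : ∀ n, N' ≤ n → B (n + T) = B n) :
    ∀ k, 1 ≤ k → ∀ n, N ≤ n → n ≡ k [MOD T] → 2 * g n = 0 := by
  intro k
  induction k using Nat.strong_induction_on with
  | _ k ih =>
    intro hk n hn hnk
    obtain ⟨p, hp, hpN, hp1⟩ := Nat.exists_prime_gt_modEq_one (N + N' + k) (k := T) (by omega)
    obtain ⟨q, hq, hqN, hq1⟩ := Nat.exists_prime_gt_modEq_one (N + N' + k + p) (k := T) (by omega)
    have hpk : ¬ p ∣ k := fun h => by have := Nat.le_of_dvd hk h; omega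
    have hqk : ¬ q ∣ k := fun h => by have := Nat.le_of_dvd hk h; omega
    have hqp : ¬ q ∣ p := fun h => by have := Nat.le_of_dvd hp.pos h; omega
    have hqkp : ¬ q ∣ k * p := fun h => (hq.dvd_mul.mp h).elim hqk hqp
    have hkp : p ≤ k * p := Nat.le_mul_of_pos_left p hk
    have hkpq : k * p ≤ k * p * q := Nat.le_mul_of_pos_right _ hq.pos
    have hkp1 : 1 ≤ k * p := Nat.mul_pos hk hp.pos
    have e1 : B (k * p * q) = B (k * p) := by
      apply per_mod B T N' hb _ _ (by omega) (by omega)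
      simpa using (Nat.ModEq.refl (k * p)).mul hq1
    rw [hB _ (by omega), hB _ hkp1, split g _ q hq hkp1 hqkp] at e1
    have e2 : ∑ d ∈ (k * p).divisors, g (d * q) = 0 := by simpa using e1
    rw [split (fun d => g (d * q)) k p hp hk hpk, ← Finset.sum_add_distrib] at e2
    have e3 : ∑ d ∈ k.divisors, 2 * g (d * q) = 0 := by
      rw [← e2]
      apply Finset.sum_congr rfl
      intro d hd
      have hd0 : 0 < d := Nat.pos_of_mem_divisors hd
      have l1 : q ≤ d * q := Nat.le_mul_of_pos_left q hd0
      have l2 : q ≤ d * p * q := Nat.le_mul_of_pos_left q (Nat.mul_pos hd0 hp.pos)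
      have : g (d * p * q) = g (d * q) := by
        apply per_mod g T N hg _ _ (by omega) (by omega)
        simpa using ((Nat.ModEq.refl d).mul hp1).mul_right q
      rw [this]; ring
    rw [Finset.sum_eq_single k] at e3
    · rw [← e3]
      congr 1
      have l1 : q ≤ k * q := Nat.le_mul_of_pos_left q hk
      apply per_mod g T N hg _ _ hn (by omega)
      refine hnk.trans ?_
      simpa using ((Nat.ModEq.refl k).mul hq1).symm
    · intro d hd hdk
      have hd0 : 0 < d := Nat.pos_of_mem_divisors hd
      have l1 : q ≤ d * q := Nat.le_mul_of_pos_left q hd0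
      have hle := Nat.divisor_le hd
      apply ih d (by omega) hd0 _ (by omega)
      simpa using (Nat.ModEq.refl d).mul hq1
    · intro h
      exact absurd (Nat.mem_divisors_self k (by omega)) h

theorem stmt_0 (γ b : ℕ → ℂ)
    (hb : ∀ n, 1 ≤ n → b n = ∑ d ∈ n.divisors, γ d)
    (hγrec : EventuallyLinRec γ) (hbrec : EventuallyLinRec b) :
    ∃ N : ℕ, ∀ n, N ≤ n → γ n = 0 := by
  obtain ⟨r, c, N, hr, hc, hrec⟩ := hγrec
  obtain ⟨r', c', N', hr', hc', hrec'⟩ := hbrec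
  refine ⟨N + 1, ?_⟩
  intro k hk
  by_contra hne
  let S : Set ℂ := γ '' (Set.Iio (N + r)) ∪ c '' (Set.Iio r) ∪ c' '' (Set.Iio r') ∪
    {(c 0)⁻¹, (2 * γ k)⁻¹}
  have hS : S.Finite := by
    refine (((Set.Finite.image _ (Set.finite_Iio _)).union
      (Set.Finite.image _ (Set.finite_Iio _))).union
      (Set.Finite.image _ (Set.finite_Iio _))).union (by simp)
  let A := Algebra.adjoin ℤ S
  have hft : Algebra.FiniteType ℤ A := Algebra.FiniteType.adjoin_of_finite hS
  have hsub : S ⊆ A := Algebra.subset_adjoin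
  have hcA : ∀ i, i < r → c i ∈ A := fun i hi =>
    hsub (Or.inl (Or.inl (Or.inr ⟨i, hi, rfl⟩)))
  have hcA' : ∀ i, i < r' → c' i ∈ A := fun i hi => hsub (Or.inl (Or.inr ⟨i, hi, rfl⟩))
  have hγA : ∀ n, γ n ∈ A := by
    intro n
    induction n using Nat.strong_induction_on with
    | _ n ih =>
      by_cases hn : n < N + r
      · exact hsub (Or.inl (Or.inl (Or.inl ⟨n, hn, rfl⟩)))
      · rw [show n = (n - r) + r by omega, hrec _ (by omega)]
        refine sum_mem fun i hi => ?_
        have := Finset.mem_range.mp hi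
        exact mul_mem (hcA i this) (ih _ (by omega))
  have hi1 : (c 0)⁻¹ ∈ A := hsub (Or.inr (by simp))
  have hi2 : (2 * γ k)⁻¹ ∈ A := hsub (Or.inr (by simp))
  obtain ⟨m, hm⟩ := Ideal.exists_maximal A
  let : Field (A ⧸ m) := Ideal.Quotient.field m
  have hfin : Finite (A ⧸ m) := finite_of_ft A _ (Ideal.Quotient.mk m) Ideal.Quotient.mk_surjective
  let φ : A →+* (A ⧸ m) := Ideal.Quotient.mk m
  let γA : ℕ → A := fun n => ⟨γ n, hγA n⟩
  let cA : ℕ → A := fun i => if h : i < r then ⟨c i, hcA i h⟩ else 0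
  let cA' : ℕ → A := fun i => if h : i < r' then ⟨c' i, hcA' i h⟩ else 0
  let bA : ℕ → A := fun n => ∑ d ∈ n.divisors, γA d
  have hbA : ∀ n, 1 ≤ n → ((bA n : A) : ℂ) = b n := by
    intro n hn
    rw [hb n hn]
    simp [bA, γA]
  have rec1 : ∀ n, N ≤ n → γA (n + r) = ∑ i ∈ Finset.range r, cA i * γA (n + i) := by
    intro n hn
    apply Subtype.ext
    push_cast
    refine (hrec n hn).trans (Finset.sum_congr rfl fun i hi => ?_)
    simp [cA, γA, Finset.mem_range.mp hi]
  have rec2 : ∀ n, N' + 1 ≤ n → bA (n + r') = ∑ i ∈ Finset.range r', cA' i * bA (n + i) := by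
    intro n hn
    apply Subtype.ext
    push_cast
    rw [hbA _ (by omega)]
    refine (hrec' n (by omega)).trans (Finset.sum_congr rfl fun i hi => ?_)
    rw [hbA _ (by omega)]
    simp [cA', Finset.mem_range.mp hi]
  have rec1' : ∀ n, N ≤ n → φ (γA (n + r)) = ∑ i ∈ Finset.range r, φ (cA i) * φ (γA (n + i)) := by
    intro n hn; rw [rec1 n hn]; simp
  have rec2' : ∀ n, N' + 1 ≤ n →
      φ (bA (n + r')) = ∑ i ∈ Finset.range r', φ (cA' i) * φ (bA (n + i)) := by
    intro n hn; rw [rec2 n hn]; simp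
  have hc0 : φ (cA 0) ≠ 0 := by
    intro h
    have h1 : cA 0 * ⟨(c 0)⁻¹, hi1⟩ = 1 := by
      apply Subtype.ext
      simp [cA, show 0 < r by omega, hc]
    have := congrArg φ h1
    rw [map_mul, h, zero_mul, map_one] at this
    exact zero_ne_one this
  obtain ⟨T1, M1, hT1, hp1⟩ := per_fwd (fun n => φ (γA n)) r N (fun i => φ (cA i)) rec1'
  obtain ⟨T2, M2, hT2, hp2⟩ := per_fwd (fun n => φ (bA n)) r' (N' + 1) (fun i => φ (cA' i)) rec2'
  have hp1' := per_pure (fun n => φ (γA n)) r N (fun i => φ (cA i)) hr hc0 rec1' T1 M1 hp1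
  have q1 : ∀ n, N ≤ n → φ (γA (n + T1 * T2)) = φ (γA n) := fun n hn =>
    per_mod (fun n => φ (γA n)) T1 N hp1' _ _ (by omega) hn (by simp [Nat.ModEq])
  have q2 : ∀ n, M2 ≤ n → φ (bA (n + T1 * T2)) = φ (bA n) := fun n hn =>
    per_mod (fun n => φ (bA n)) T2 M2 hp2 _ _ (by omega) hn (by simp [Nat.ModEq])
  have fin := core (fun n => φ (γA n)) (fun n => φ (bA n)) (fun n _ => by simp [bA])
    (T1 * T2) N M2 (Nat.mul_pos hT1 hT2) q1 q2 k (by omega) k (by omega) rfl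
  have h1 : (2 * γA k) * ⟨(2 * γ k)⁻¹, hi2⟩ = 1 := by
    apply Subtype.ext
    exact mul_inv_cancel₀ (mul_ne_zero two_ne_zero hne)
  have := congrArg φ h1
  rw [map_mul, map_mul, map_ofNat, fin, zero_mul, map_one] at this
  exact zero_ne_one this
end

section
/- (Skolem–Mahler–Lech) Let (a_n)_{n≥0} be an eventually linearly recurrent complex sequence (equivalently, the coefficient sequence of a rational power series). Then the zero set Z := {n ≥ 0 : a_n = 0} is the union of a finite set and finitely many (full) arithmetic progressions; in particular, Z is eventually periodic: there exist M ≥ 1 and N such that for all n ≥ N, a_n = 0 if and only if a_{n+M} = 0. -/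
open Polynomial

lemma sml_desc {V : Type*} [CommRing V] (N k : ℕ) :
    ∏ i ∈ Finset.range k, ((N : V) - i) = (N.descFactorial k : V) := by
  induction k with
  | zero => simp
  | succ k ih =>
    rw [Finset.prod_range_succ, ih, Nat.descFactorial_succ]
    rcases le_or_gt k N with h | h
    · push_cast [Nat.cast_sub h]; ring
    · simp [Nat.descFactorial_eq_zero_iff_lt.mpr h]

lemma sml_prod_dvd {V : Type*} [CommRing V] [IsDomain V] (s : Finset ℕ) (g : ℕ → V)
    (hg : Set.InjOn g s) (G : V[X]) (hG : ∀ i ∈ s, G.eval (g i) = 0) :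
    ∏ i ∈ s, (X - C (g i)) ∣ G := by
  induction s using Finset.induction_on with
  | empty => simp
  | insert a s ha ih =>
    obtain ⟨Q, hQ⟩ := ih (hg.mono (by simp)) (fun i hi => hG i (by simp [hi]))
    have h := hG a (by simp)
    rw [hQ, eval_mul, eval_prod] at h
    have h3 : ∏ i ∈ s, eval (g a) (X - C (g i)) ≠ 0 := by
      rw [Finset.prod_ne_zero_iff]
      intro i hi h0
      have : g a = g i := by simpa [sub_eq_zero] using h0
      have := hg (by simp) (by simp [hi]) this
      exact ha (this ▸ hi)
    have h4 : X - C (g a) ∣ Q := dvd_iff_isRoot.mpr ((mul_eq_zero.mp h).resolve_left h3)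
    rw [Finset.prod_insert ha, hQ, mul_comm]
    exact mul_dvd_mul_left _ h4

lemma sml_key {V : Type*} [CommRing V] [IsDomain V] [CharZero V] (p : ℕ) (hp : p.Prime)
    (hK : ∀ v : V, (∀ n : ℕ, (p : V) ^ n ∣ v) → v = 0) (b : ℕ → V) (f : ℕ → V)
    (hf : ∀ n, f n = ∑ k ∈ Finset.range (n + 1), (n.choose k : V) * ((p : V) ^ (2 * k) * b k))
    (hinf : {n | f n = 0}.Infinite) (n : ℕ) : f n = 0 := by
  apply hK
  intro J
  obtain ⟨s, hs, hcard⟩ := hinf.exists_subset_card_eq J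
  obtain ⟨L, hLn, hLs⟩ : ∃ L, n ≤ L ∧ ∀ i ∈ s, i ≤ L :=
    ⟨max n (s.sup id), le_max_left _ _, fun i hi => le_max_of_le_right (Finset.le_sup (f := id) hi)⟩
  have := Fact.mk hp
  set m : ℕ := ordCompl[p] L.factorial with hm
  have hcop : Nat.Coprime p m := Nat.coprime_ordCompl hp (Nat.factorial_ne_zero _)
  -- integers w k with m * p^k = w k * k!
  have hw : ∀ k, k ≤ L → ∃ w : ℕ, m * p ^ k = w * k.factorial := by
    intro k hk
    have h1 : ordCompl[p] k.factorial ∣ m :=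
      Nat.ordCompl_dvd_ordCompl_of_dvd (Nat.factorial_dvd_factorial hk) p
    have h2 : ordProj[p] k.factorial ∣ p ^ k := by
      apply pow_dvd_pow
      rw [Nat.factorization_def _ hp]
      exact padicValNat_factorial_le (p := p) k
    have h3 := mul_dvd_mul h1 h2
    rw [mul_comm (ordCompl[p] _), Nat.ordProj_mul_ordCompl_eq_self] at h3
    obtain ⟨w, hw⟩ := h3
    exact ⟨w, by rw [hw, mul_comm]⟩
  choose! w hw using hw
  let G : V[X] := ∑ k ∈ Finset.range (L + 1),
    C ((w k : V) * b k) * ∏ i ∈ Finset.range k, (X - C ((p : V) * i))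
  have hprod : ∀ N k : ℕ, ∏ i ∈ Finset.range k, ((p : V) * N - p * i)
      = (p : V) ^ k * (N.choose k * k.factorial : ℕ) := by
    intro N k
    rw [mul_comm (N.choose k), ← Nat.descFactorial_eq_factorial_mul_choose]
    have : ∀ i ∈ Finset.range k, ((p : V) * N - p * i) = p * ((N : V) - i) := by
      intros; ring
    rw [Finset.prod_congr rfl this, Finset.prod_mul_distrib, Finset.prod_const, Finset.card_range,
      sml_desc]
  have hG : ∀ N, N ≤ L → G.eval ((p : V) * N) = m * f N := by
    intro N hN
    rw [hf, Finset.mul_sum]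
    have : ∑ k ∈ Finset.range (N + 1), (m : V) * ((N.choose k : V) * ((p : V) ^ (2 * k) * b k)) =
      ∑ k ∈ Finset.range (L + 1), (m : V) * ((N.choose k : V) * ((p : V) ^ (2 * k) * b k)) := by
      apply Finset.sum_subset
      · intro i; simp; omega
      · intro i _ hi
        have : N < i := by simpa using hi
        simp [Nat.choose_eq_zero_of_lt this]
    rw [this]
    simp only [G, eval_finsetSum, eval_mul, eval_C, eval_prod, eval_sub, eval_X]
    apply Finset.sum_congr rfl
    intro k hk
    have hk' : k ≤ L := by simpa [Nat.lt_succ_iff] using hk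
    rw [hprod]
    have h := congrArg (Nat.cast : ℕ → V) (hw k hk')
    push_cast at h ⊢
    linear_combination (-(b k) * (p : V) ^ k * (N.choose k : V)) * h
  have hdiv : ∏ i ∈ s, (X - C ((p : V) * i)) ∣ G := by
    apply sml_prod_dvd
    · intro i _ j _ hij
      have : (p : V) ≠ 0 := by exact_mod_cast hp.ne_zero
      simpa [this] using hij
    · intro i hi
      rw [hG i (hLs i hi)]
      have : f i = 0 := hs hi
      simp [this]
  obtain ⟨H, hH⟩ := hdiv
  have h1 : (p : V) ^ J ∣ m * f n := by
    rw [← hG n hLn, hH, eval_mul, eval_prod]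
    apply Dvd.dvd.mul_right
    rw [← hcard, ← Finset.prod_const]
    apply Finset.prod_dvd_prod_of_dvd
    intro i _
    simp only [eval_sub, eval_X, eval_C]
    exact ⟨n - i, by ring⟩
  have h2 : IsCoprime ((p : V) ^ J) (m : V) := by
    apply IsCoprime.pow_left
    simpa using (Nat.isCoprime_iff_coprime.mpr hcop).map (Int.castRingHom V)
  exact h2.dvd_of_dvd_mul_left h1

lemma sml_core {V B : Type*} [CommRing V] [IsDomain V] [CharZero V] [CommRing B] [Algebra V B]
    (p : ℕ) (hp : p.Prime)
    (hK : ∀ v : V, (∀ n : ℕ, (p : V) ^ n ∣ v) → v = 0) (l : B →ₗ[V] V) (x : B) (M : ℕ)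
    (hM : ((p : B) ^ 2) ∣ x ^ M - 1) (s : ℕ) :
    {n | l (x ^ (s + M * n)) = 0}.Finite ∨ ∀ n, l (x ^ (s + M * n)) = 0 := by
  by_cases h : {n | l (x ^ (s + M * n)) = 0}.Finite
  · exact Or.inl h
  right
  obtain ⟨θ, hθ⟩ := hM
  refine sml_key p hp hK (fun k => l (x ^ s * θ ^ k)) (fun n => l (x ^ (s + M * n))) ?_ h
  intro n
  have : x ^ M = (p : B) ^ 2 * θ + 1 := by rw [← hθ]; ring
  rw [pow_add, pow_mul, this, add_pow, Finset.mul_sum, map_sum]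
  apply Finset.sum_congr rfl
  intro k _
  have : x ^ s * (((p : B) ^ 2 * θ) ^ k * 1 ^ (n - k) * (n.choose k : B)) =
    ((n.choose k : V) * (p : V) ^ (2 * k)) • (x ^ s * θ ^ k) := by
    rw [Algebra.smul_def]
    push_cast [map_mul, map_pow, map_natCast]
    ring
  rw [this, map_smul, smul_eq_mul]
  ring

lemma sml_order {B : Type*} [CommRing B] (p : ℕ) (hp : p.Prime) (x : B) (hx : IsUnit x)
    (hint : IsIntegral ℤ (Ideal.Quotient.mk (Ideal.span {(p : B)}) x)) :
    ∃ M, 1 ≤ M ∧ ((p : B) ^ 2) ∣ x ^ M - 1 := by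
  set I := Ideal.span {(p : B)}
  set y := Ideal.Quotient.mk I x with hy
  have hu : IsUnit y := hx.map _
  have hp0 : ((p : ℕ) : B ⧸ I) = 0 := by
    have : Ideal.Quotient.mk I (p : B) = 0 :=
      Ideal.Quotient.eq_zero_iff_mem.mpr (Ideal.mem_span_singleton_self _)
    simpa using this
  have hfin : Module.Finite ℤ (Algebra.adjoin ℤ {y}) :=
    Module.Finite.iff_fg.mpr hint.fg_adjoin_singleton
  have : Finite (Algebra.adjoin ℤ {y}) := by
    apply Module.finite_of_fg_torsion
    intro a
    refine ⟨⟨(p : ℤ), mem_nonZeroDivisors_of_ne_zero (by exact_mod_cast hp.ne_zero)⟩, ?_⟩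
    apply Subtype.ext
    simp [Submonoid.smul_def, hp0]
  let g : ℕ → Algebra.adjoin ℤ {y} := fun n => ⟨y ^ n, pow_mem (Algebra.self_mem_adjoin_singleton ℤ y) n⟩
  obtain ⟨i, j, hij, hgij⟩ := Finite.exists_ne_map_eq_of_infinite g
  have hyij : y ^ i = y ^ j := congrArg Subtype.val hgij
  have key : ∃ M, 1 ≤ M ∧ y ^ M = 1 := by
    rcases lt_or_gt_of_ne hij with h | h
    · refine ⟨j - i, by omega, ?_⟩
      apply (hu.pow i).mul_left_cancel
      rw [← pow_add, mul_one, hyij]; congr 1; omega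
    · refine ⟨i - j, by omega, ?_⟩
      apply (hu.pow j).mul_left_cancel
      rw [← pow_add, mul_one, ← hyij]; congr 1; omega
  obtain ⟨M, hM1, hM⟩ := key
  have hd : (p : B) ∣ x ^ M - 1 := by
    rw [← Ideal.mem_span_singleton, ← Ideal.Quotient.eq_zero_iff_mem]
    simp [I] at hM ⊢
    rw [← hy, hM]; simp
  refine ⟨M * p, Nat.mul_pos hM1 hp.pos, ?_⟩
  have := dvd_sub_pow_of_dvd_sub hd 1
  simpa [pow_mul] using this

lemma sml_rec {V : Type*} [CommRing V] [IsDomain V] [CharZero V]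
    (p : ℕ) (hp : p.Prime)
    (hK : ∀ v : V, (∀ n : ℕ, (p : V) ^ n ∣ v) → v = 0) (r : ℕ) (hr : 1 ≤ r) (c u : ℕ → V)
    (hc0 : IsUnit (c 0)) (hc : ∀ i < r, ∃ g : ℤ[X], g.Monic ∧ (p : V) ∣ aeval (c i) g)
    (hu : ∀ n, u (n + r) = ∑ i ∈ Finset.range r, c i * u (n + i)) :
    ∃ M, 1 ≤ M ∧ ∀ s, {n | u (s + M * n) = 0}.Finite ∨ ∀ n, u (s + M * n) = 0 := by
  let q : V[X] := ∑ i ∈ Finset.range r, C (c i) * X ^ i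
  have hq : q.degree < r := by
    apply (degree_sum_le _ _).trans_lt
    rw [Finset.sup_lt_iff (by simp [bot_lt_iff_ne_bot])]
    intro i hi
    apply (degree_C_mul_X_pow_le _ _).trans_lt
    exact_mod_cast Finset.mem_range.mp hi
  let χ : V[X] := X ^ r - q
  have hχ : χ.Monic := monic_X_pow_sub hq
  have hdeg : χ.natDegree = r := by
    apply natDegree_eq_of_degree_eq_some
    have : (X ^ r - q).degree = (X ^ r : V[X]).degree := degree_sub_eq_left_of_degree_lt (by simpa using hq)
    simpa [χ] using this
  let x := AdjoinRoot.root χ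
  have hroot : x ^ r = ∑ i ∈ Finset.range r, algebraMap V (AdjoinRoot χ) (c i) * x ^ i := by
    have h : aeval x χ = 0 := by
      rw [AdjoinRoot.aeval_eq, AdjoinRoot.mk_self]
    simp only [χ, q, map_sub, map_pow, aeval_X, map_sum, map_mul, aeval_C] at h
    exact sub_eq_zero.mp h
  let pb := AdjoinRoot.powerBasis' hχ
  have hdim : pb.dim = r := by simp [pb, hdeg]
  have hgen : pb.gen = x := by simp [pb, x]
  let l : AdjoinRoot χ →ₗ[V] V := pb.basis.constr V (fun i => u i)
  have hl : ∀ n, l (x ^ n) = u n := by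
    intro n
    induction n using Nat.strong_induction_on with
    | _ n ih =>
      rcases lt_or_ge n r with h | h
      · have := pb.basis.constr_basis V (fun i => u i) ⟨n, by omega⟩
        rw [pb.basis_eq_pow] at this
        rw [← hgen]; exact this
      · obtain ⟨k, rfl⟩ := Nat.exists_eq_add_of_le' h
        rw [pow_add, hroot, Finset.mul_sum, map_sum, hu]
        apply Finset.sum_congr rfl
        intro i hi
        have hi' := Finset.mem_range.mp hi
        rw [← ih (k + i) (by omega), mul_left_comm, ← pow_add, ← Algebra.smul_def, map_smul, smul_eq_mul]
  have hxu : IsUnit x := by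
    obtain ⟨t, rfl⟩ := Nat.exists_eq_add_of_le' hr
    rw [Finset.sum_range_succ'] at hroot
    have h0 : IsUnit (algebraMap V (AdjoinRoot χ) (c 0)) := hc0.map _
    have : algebraMap V (AdjoinRoot χ) (c 0) =
      x * (x ^ t - ∑ i ∈ Finset.range t, algebraMap V (AdjoinRoot χ) (c (i + 1)) * x ^ i) := by
      rw [mul_sub, ← pow_succ', hroot, Finset.mul_sum]
      have : ∀ i ∈ Finset.range t, x * (algebraMap V (AdjoinRoot χ) (c (i + 1)) * x ^ i) =
        algebraMap V (AdjoinRoot χ) (c (i + 1)) * x ^ (i + 1) := by intros; ring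
      rw [Finset.sum_congr rfl this]; simp
    rw [this] at h0
    exact isUnit_of_mul_isUnit_left h0
  have hint : IsIntegral ℤ (Ideal.Quotient.mk (Ideal.span {(p : AdjoinRoot χ)}) x) := by
    set I := Ideal.span {(p : AdjoinRoot χ)} with hI
    let φ : V →+* AdjoinRoot χ ⧸ I := (Ideal.Quotient.mk I).comp (algebraMap V (AdjoinRoot χ))
    have hci : ∀ i < r, φ (c i) ∈ integralClosure ℤ (AdjoinRoot χ ⧸ I) := by
      intro i hi
      obtain ⟨g, hg, v, hv⟩ := hc i hi
      refine ⟨g, hg, ?_⟩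
      have h1 := congrArg φ hv
      have h2 : φ (p : V) = 0 := by
        have : φ (p : V) = Ideal.Quotient.mk I (p : AdjoinRoot χ) := by simp [φ]
        rw [this]
        exact Ideal.Quotient.eq_zero_iff_mem.mpr (Ideal.mem_span_singleton_self _)
      rw [map_mul, h2, zero_mul, aeval_def, hom_eval₂] at h1
      rw [show φ.comp (algebraMap ℤ V) = algebraMap ℤ _ from RingHom.ext_int _ _] at h1
      exact h1
    choose! d hd using fun i (hi : i < r) => (⟨⟨φ (c i), hci i hi⟩, rfl⟩ :
      ∃ d : integralClosure ℤ (AdjoinRoot χ ⧸ I), (d : AdjoinRoot χ ⧸ I) = φ (c i))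
    let Q : (integralClosure ℤ (AdjoinRoot χ ⧸ I))[X] := ∑ i ∈ Finset.range r, C (d i) * X ^ i
    have hQ : Q.degree < r := by
      apply (degree_sum_le _ _).trans_lt
      rw [Finset.sup_lt_iff (by simp [bot_lt_iff_ne_bot])]
      intro i hi
      apply (degree_C_mul_X_pow_le _ _).trans_lt
      exact_mod_cast Finset.mem_range.mp hi
    have : IsIntegral (integralClosure ℤ (AdjoinRoot χ ⧸ I)) (Ideal.Quotient.mk I x) := by
      refine ⟨X ^ r - Q, monic_X_pow_sub hQ, ?_⟩
      rw [eval₂_sub, eval₂_X_pow, ← map_pow, hroot, map_sum, eval₂_finsetSum, sub_eq_zero]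
      apply Finset.sum_congr rfl
      intro i hi
      rw [eval₂_mul, eval₂_C, eval₂_X_pow, map_mul, map_pow]
      congr 1
      exact (hd i (Finset.mem_range.mp hi)).symm
    exact isIntegral_trans _ this
  obtain ⟨M, hM1, hM⟩ := sml_order p hp x hxu hint
  refine ⟨M, hM1, fun s => ?_⟩
  have := sml_core p hp hK l x M hM s
  simpa only [hl] using this

lemma sml_basis (Z : Finset ℂ) : ∃ (ι : Type) (_ : Finite ι) (x : ι → ℂ),
    AlgebraicIndependent ℤ x ∧ ∀ z ∈ Z, ∃ P : (MvPolynomial ι ℤ)[X], P ≠ 0 ∧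
      eval₂ (MvPolynomial.aeval x : MvPolynomial ι ℤ →ₐ[ℤ] ℂ).toRingHom z P = 0 := by
  obtain ⟨s, hs⟩ := (AlgebraicIndependent.matroid ℤ ℂ).exists_isBasis (Z : Set ℂ)
  rw [AlgebraicIndependent.matroid_isBasis_iff] at hs
  obtain ⟨h1, h2, h3⟩ := hs
  have h1' : AlgebraicIndependent ℤ (Subtype.val : s → ℂ) := h1
  refine ⟨s, (Z.finite_toSet.subset h2), Subtype.val, h1', ?_⟩
  intro z hz
  have h4 := h3 z hz
  have h5 : IsAlgebraic (Algebra.adjoin ℤ (Set.range (Subtype.val : s → ℂ))) z := by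
    rw [Subtype.range_val]; exact h4
  obtain ⟨P, hP, hPz⟩ := h5
  let e := h1'.aevalEquiv
  refine ⟨P.map e.symm.toRingEquiv.toRingHom, ?_, ?_⟩
  · rwa [Ne, Polynomial.map_eq_zero_iff]
    exact e.symm.injective
  · rw [eval₂_map, ← hPz, aeval_def]
    congr 1
    ext w
    have := h1'.algebraMap_aevalEquiv (e.symm w)
    simp only [e, AlgEquiv.apply_symm_apply] at this
    exact this.symm

lemma sml_int (q : ℕ) (hq : q ≠ 0) (S : Subalgebra ℤ ℂ) (h : IsIntegral S ((q : ℂ)⁻¹)) : (q : ℂ)⁻¹ ∈ S := by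
  have hq' : (q : ℂ) ≠ 0 := by exact_mod_cast hq
  have hu : IsUnit (algebraMap S (integralClosure S ℂ) (q : S)) := by
    refine IsUnit.of_mul_eq_one ⟨_, h⟩ ?_
    apply Subtype.ext
    simp [hq']
  have hloc : IsLocalHom (algebraMap S (integralClosure S ℂ)) := by
    apply RingHom.IsIntegral.isLocalHom
    · exact fun w => integralClosure.isIntegral w
    · intro a b hab
      exact Subtype.ext (congrArg (fun t : integralClosure S ℂ => (t : ℂ)) hab)
  have := (isUnit_map_iff (algebraMap S (integralClosure S ℂ)) (q : S)).mp hu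
  obtain ⟨w, hw⟩ := this.exists_right_inv
  have h2 : (q : ℂ) * w = 1 := by simpa using congrArg Subtype.val hw
  rw [inv_eq_of_mul_eq_one_right h2]
  exact w.2

lemma sml_ring (Z : Finset ℂ) : ∃ (p : ℕ) (V : Subalgebra ℤ ℂ), p.Prime ∧
    (∀ v : V, (∀ n : ℕ, (p : V) ^ n ∣ v) → v = 0) ∧
    ∀ z ∈ Z, ∃ hz : z ∈ V, ∃ g : ℤ[X], g.Monic ∧ (p : V) ∣ aeval (⟨z, hz⟩ : V) g := by
  obtain ⟨ι, _, x, hx, hP⟩ := sml_basis Z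
  choose! P hP0 hPz using hP
  let D : MvPolynomial ι ℤ := ∏ z ∈ Z, (P z).leadingCoeff
  have hD0 : D ≠ 0 := Finset.prod_ne_zero_iff.mpr fun z hz => leadingCoeff_ne_zero.mpr (hP0 z hz)
  obtain ⟨a, ha⟩ : ∃ a : ι → ℤ, MvPolynomial.eval a D ≠ 0 := by
    by_contra! h
    exact hD0 (MvPolynomial.funext (by simpa using h))
  obtain ⟨p, hpN, hp⟩ := Nat.exists_infinite_primes ((MvPolynomial.eval a D).natAbs + 1)
  have hpD : ¬ (p : ℤ) ∣ MvPolynomial.eval a D := by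
    intro h
    have := Int.natAbs_dvd_natAbs.mpr h
    have := Nat.le_of_dvd (Int.natAbs_pos.mpr ha) this
    simp at this
    omega
  have hp0 : (p : ℂ) ≠ 0 := by exact_mod_cast hp.ne_zero
  let y : ι → ℂ := fun i => (x i - a i) / p
  let δ : ℂ := MvPolynomial.aeval x D
  have hδ0 : δ ≠ 0 := by
    intro h
    exact hD0 (hx (by simpa [δ] using h))
  let Y : Subalgebra ℤ ℂ := Algebra.adjoin ℤ (Set.range y)
  let S : Subalgebra ℤ ℂ := Algebra.adjoin ℤ (Set.range y ∪ {δ⁻¹})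
  let V : Subalgebra ℤ ℂ := Algebra.adjoin ℤ ((Set.range y ∪ {δ⁻¹}) ∪ Z)
  have hYS : Y ≤ S := Algebra.adjoin_mono (by simp)
  have hSV : S ≤ V := Algebra.adjoin_mono (by simp)
  have hyY : ∀ i, y i ∈ Y := fun i => Algebra.subset_adjoin ⟨i, rfl⟩
  have hδS : δ⁻¹ ∈ S := Algebra.subset_adjoin (by simp)
  -- reduction of polynomials mod p
  have F1 : ∀ Q : MvPolynomial ι ℤ, ∃ w ∈ Y,
      MvPolynomial.aeval x Q = ((MvPolynomial.eval a Q : ℤ) : ℂ) + p * w := by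
    intro Q
    induction Q using MvPolynomial.induction_on with
    | C c => exact ⟨0, zero_mem _, by simp⟩
    | add f g hf hg =>
      obtain ⟨w, hw, h1⟩ := hf
      obtain ⟨w', hw', h1'⟩ := hg
      exact ⟨w + w', add_mem hw hw', by rw [map_add, h1, h1']; push_cast [map_add]; ring⟩
    | mul_X f i hf =>
      obtain ⟨w, hw, h1⟩ := hf
      refine ⟨((MvPolynomial.eval a f : ℤ) : ℂ) * y i + w * a i + p * w * y i, ?_, ?_⟩
      · exact add_mem (add_mem (mul_mem (intCast_mem _ _) (hyY i)) (mul_mem hw (intCast_mem _ _)))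
          (mul_mem (mul_mem (natCast_mem _ _) hw) (hyY i))
      · have hxy : x i = a i + p * y i := by simp only [y]; field_simp; ring
        rw [map_mul, h1, MvPolynomial.aeval_X, hxy]; push_cast [map_mul, MvPolynomial.eval_X]; ring
  have F1' : ∀ Q : MvPolynomial ι ℤ, MvPolynomial.aeval x Q ∈ Y := by
    intro Q
    obtain ⟨w, hw, h⟩ := F1 Q
    rw [h]
    exact add_mem (intCast_mem _ _) (mul_mem (natCast_mem _ _) hw)
  have hZV : ∀ z ∈ Z, z ∈ V := fun z hz => Algebra.subset_adjoin (Or.inr hz)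
  -- integrality over S
  have F2 : ∀ z ∈ Z, IsIntegral S z := by
    intro z hz
    let ψ : MvPolynomial ι ℤ →+* S :=
      (MvPolynomial.aeval x : MvPolynomial ι ℤ →ₐ[ℤ] ℂ).toRingHom.codRestrict S
        (fun Q => hYS (F1' Q))
    have hψ : ∀ Q, ((ψ Q : S) : ℂ) = MvPolynomial.aeval x Q := fun Q => rfl
    set α : ℂ := MvPolynomial.aeval x (P z).leadingCoeff with hα
    have hδα : δ = α * MvPolynomial.aeval x (∏ w ∈ Z.erase z, (P w).leadingCoeff) := by
      rw [hα, ← map_mul, Finset.mul_prod_erase Z (fun w => (P w).leadingCoeff) hz]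
    have hα0 : α ≠ 0 := by
      intro h; rw [h, zero_mul] at hδα; exact hδ0 hδα
    have hαS : α⁻¹ ∈ S := by
      have : α⁻¹ = δ⁻¹ * MvPolynomial.aeval x (∏ w ∈ Z.erase z, (P w).leadingCoeff) := by
        rw [eq_inv_mul_iff_mul_eq₀ hδ0, hδα]; field_simp
      rw [this]
      exact mul_mem hδS (hYS (F1' _))
    have hlc : ((P z).map ψ).leadingCoeff = ψ (P z).leadingCoeff := by
      apply leadingCoeff_map_of_leadingCoeff_ne_zero
      intro h
      apply hα0
      rw [hα, ← hψ, h]; rfl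
    have h1 : aeval z ((P z).map ψ) = 0 := by
      rw [aeval_def, eval₂_map, ← hPz z hz]; rfl
    have h2 := isIntegral_leadingCoeff_smul ((P z).map ψ) z h1
    have h3 : IsIntegral S (α⁻¹) := isIntegral_algebraMap (x := (⟨α⁻¹, hαS⟩ : S))
    have h4 := h3.mul h2
    rw [hlc] at h4
    have h5 : α⁻¹ * (ψ (P z).leadingCoeff • z) = z := by
      change α⁻¹ * (α * z) = z
      field_simp
    rw [h5] at h4
    exact h4
  -- elements of S
  have F3 : ∀ w ∈ S, ∃ (g : MvPolynomial ι ℤ) (k : ℕ), w * δ ^ k = MvPolynomial.aeval y g := by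
    let D' : MvPolynomial ι ℤ :=
      MvPolynomial.aeval (fun i => MvPolynomial.C (a i) + MvPolynomial.C (p : ℤ) * MvPolynomial.X i) D
    have hD' : MvPolynomial.aeval y D' = δ := by
      simp only [D', δ]
      rw [← AlgHom.comp_apply]
      congr 1
      ext i
      simp [y]
      field_simp
      ring
    intro w hw
    induction hw using Algebra.adjoin_induction with
    | mem w hw =>
      rcases hw with ⟨i, rfl⟩ | hw
      · exact ⟨MvPolynomial.X i, 0, by simp⟩
      · have : w = δ⁻¹ := hw
        exact ⟨1, 1, by simp [this, hδ0]⟩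
    | algebraMap c => exact ⟨MvPolynomial.C c, 0, by simp⟩
    | add u v _ _ hu hv =>
      obtain ⟨g, k, h⟩ := hu
      obtain ⟨g', k', h'⟩ := hv
      refine ⟨g * D' ^ k' + g' * D' ^ k, k + k', ?_⟩
      simp only [map_add, map_mul, map_pow, hD', ← h, ← h']
      ring
    | mul u v _ _ hu hv =>
      obtain ⟨g, k, h⟩ := hu
      obtain ⟨g', k', h'⟩ := hv
      refine ⟨g * g', k + k', ?_⟩
      simp only [map_mul, ← h, ← h']
      ring
  have F4 : (p : ℂ)⁻¹ ∉ S := by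
    intro h
    obtain ⟨g, k, hg⟩ := F3 _ h
    have : Algebra.IsAlgebraic ℤ ℚ := IsLocalization.isAlgebraic ℚ (nonZeroDivisors ℤ)
    have hxQ : AlgebraicIndependent ℚ x := hx.extendScalars ℚ
    let L : ι → MvPolynomial ι ℚ := fun i =>
      MvPolynomial.C ((p : ℚ)⁻¹) * (MvPolynomial.X i - MvPolynomial.C (a i : ℚ))
    let E₁ : MvPolynomial ι ℚ := MvPolynomial.aeval (MvPolynomial.X : ι → MvPolynomial ι ℚ) D
    let E₂ : MvPolynomial ι ℚ := MvPolynomial.aeval L g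
    have hE₁ : ∀ (t : ι → ℂ), MvPolynomial.aeval t E₁ = MvPolynomial.aeval t D := by
      intro t
      simp only [E₁]
      rw [← AlgHom.restrictScalars_apply ℤ (MvPolynomial.aeval t), ← AlgHom.comp_apply]
      congr 1
      ext i
      simp
    have hE₂ : ∀ (t : ι → ℂ), MvPolynomial.aeval t E₂ =
        MvPolynomial.aeval (fun i => (t i - a i) / (p : ℂ)) g := by
      intro t
      simp only [E₂]
      rw [← AlgHom.restrictScalars_apply ℤ (MvPolynomial.aeval t), ← AlgHom.comp_apply]
      congr 1
      ext i
      simp [L]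
      ring
    have hE : E₁ ^ k = MvPolynomial.C (p : ℚ) * E₂ := by
      apply hxQ
      rw [map_pow, map_mul, hE₁, hE₂]
      change δ ^ k = _ * MvPolynomial.aeval y g
      rw [← hg]
      simp [hp0]
    have h1 := congrArg (MvPolynomial.aeval (fun i => ((a i : ℤ) : ℂ))) hE
    rw [map_pow, map_mul, hE₁, hE₂] at h1
    have h2 : ∀ (b : ι → ℤ) (Q : MvPolynomial ι ℤ),
        MvPolynomial.aeval (fun i => ((b i : ℤ) : ℂ)) Q = ((MvPolynomial.eval b Q : ℤ) : ℂ) := by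
      intro b Q
      have := MvPolynomial.aeval_algebraMap_apply ℂ b Q
      simpa [MvPolynomial.coe_aeval_eq_eval, Function.comp_def] using this
    have h3 := h2 0 g
    simp only [Pi.zero_apply, Int.cast_zero] at h3
    simp only [h2, sub_self, zero_div, h3] at h1
    have h4 : (MvPolynomial.eval a D) ^ k = (p : ℤ) * MvPolynomial.eval 0 g := by
      rw [MvPolynomial.aeval_C] at h1
      simp only [map_natCast] at h1
      exact_mod_cast h1
    exact hpD ((Nat.prime_iff_prime_int.mp hp).dvd_of_dvd_pow ⟨_, h4⟩)
  have F5 : (p : ℂ)⁻¹ ∉ V := by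
    intro h
    apply F4
    apply sml_int p hp.ne_zero
    have : V ≤ (integralClosure S ℂ).restrictScalars ℤ := by
      apply Algebra.adjoin_le
      rintro w (hw | hw)
      · exact isIntegral_algebraMap (x := (⟨w, Algebra.subset_adjoin hw⟩ : S))
      · exact F2 w hw
    exact this h
  refine ⟨p, V, hp, ?_, ?_⟩
  · have hfg : V.FG := Subalgebra.fg_def.mpr ⟨_,
      ((Set.finite_range y).union (Set.finite_singleton _)).union Z.finite_toSet, rfl⟩
    have : Algebra.FiniteType ℤ V := (Subalgebra.fg_iff_finiteType V).mp hfg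
    have : IsNoetherianRing V := Algebra.FiniteType.isNoetherianRing ℤ V
    intro v hv
    have hne : Ideal.span {(p : V)} ≠ ⊤ := by
      rw [Ne, Ideal.span_singleton_eq_top]
      intro hu
      obtain ⟨w, hw⟩ := hu.exists_right_inv
      have h2 : (p : ℂ) * w = 1 := by simpa using congrArg Subtype.val hw
      apply F5
      rw [inv_eq_of_mul_eq_one_right h2]
      exact w.2
    have := Ideal.iInf_pow_eq_bot_of_isDomain _ hne
    rw [← Ideal.mem_bot, ← this, Ideal.mem_iInf]
    intro n
    rw [Ideal.span_singleton_pow, Ideal.mem_span_singleton]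
    exact hv n
  · intro z hz
    refine ⟨hZV z hz, ?_⟩
    set N := MvPolynomial.eval a (P z).leadingCoeff with hN
    have hNp : ¬ (p : ℤ) ∣ N := by
      intro h
      apply hpD
      simp only [D, map_prod]
      exact h.trans (Finset.dvd_prod_of_mem (fun w => MvPolynomial.eval a (P w).leadingCoeff) hz)
    have hcop : IsCoprime (p : ℤ) N :=
      ((Nat.prime_iff_prime_int.mp hp).irreducible.coprime_iff_not_dvd).mpr hNp
    obtain ⟨k, n', hkn⟩ := hcop
    set d := (P z).natDegree
    let Pa : ℤ[X] := (P z).map (MvPolynomial.eval a)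
    refine ⟨C n' * Pa + C (k * p) * X ^ d, ?_, ?_⟩
    · apply monic_of_natDegree_le_of_coeff_eq_one d
      · apply natDegree_add_le_of_degree_le
        · exact (natDegree_C_mul_le _ _).trans natDegree_map_le
        · exact natDegree_C_mul_X_pow_le _ _
      · have : (P z).coeff d = (P z).leadingCoeff := rfl
        simp only [Pa, coeff_add, coeff_C_mul, coeff_map, coeff_X_pow, this, ← hN]
        simp
        linarith
    · have h1 : ∃ w ∈ V, aeval z Pa = p * w := by
        choose w hw hw' using F1
        refine ⟨∑ i ∈ Finset.range (d + 1), - (w ((P z).coeff i)) * z ^ i, ?_, ?_⟩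
        · exact sum_mem fun i _ => mul_mem (neg_mem (hSV (hYS (hw _)))) (pow_mem (hZV z hz) i)
        · have h0 := hPz z hz
          rw [eval₂_eq_sum_range] at h0
          have h0' : ∑ i ∈ Finset.range (d + 1),
            (((MvPolynomial.eval a ((P z).coeff i) : ℤ) : ℂ) + p * w ((P z).coeff i)) * z ^ i = 0 := by
            rw [← h0]
            apply Finset.sum_congr rfl
            intro i _
            rw [← hw']; rfl
          simp only [Pa]
          rw [aeval_def, eval₂_map, eval₂_eq_sum_range, ← sub_zero (Finset.sum _ _), ← h0',
            ← Finset.sum_sub_distrib, Finset.mul_sum]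
          apply Finset.sum_congr rfl
          intro i _
          simp
          ring
      obtain ⟨w, hwV, hw⟩ := h1
      refine ⟨⟨n' * w + k * z ^ d, add_mem (mul_mem (intCast_mem _ _) hwV)
        (mul_mem (intCast_mem _ _) (pow_mem (hZV z hz) d))⟩, ?_⟩
      apply Subtype.ext
      have hc : ((aeval (⟨z, hZV z hz⟩ : V) (C n' * Pa + C (k * p) * X ^ d) : V) : ℂ)
        = aeval z (C n' * Pa + C (k * p) * X ^ d) := (aeval_algebraMap_apply ℂ (⟨z, hZV z hz⟩ : V) _).symm
      rw [hc]
      simp [hw]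
      ring

lemma sml_rec_complex (u : ℕ → ℂ) (r : ℕ) (c : ℕ → ℂ) (hr : 1 ≤ r) (hc0 : c 0 ≠ 0)
    (hu : ∀ n, u (n + r) = ∑ i ∈ Finset.range r, c i * u (n + i)) :
    ∃ M, 1 ≤ M ∧ ∀ s, {n | u (s + M * n) = 0}.Finite ∨ ∀ n, u (s + M * n) = 0 := by
  classical
  obtain ⟨p, V, hp, hK, hZ⟩ := sml_ring ((Finset.range r).image c ∪ (Finset.range r).image u ∪ {(c 0)⁻¹})
  have hcV : ∀ i < r, c i ∈ V := fun i hi => (hZ (c i) (by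
    simp only [Finset.mem_union, Finset.mem_image, Finset.mem_range]
    exact Or.inl (Or.inl ⟨i, hi, rfl⟩))).1
  have huV0 : ∀ i < r, u i ∈ V := fun i hi => (hZ (u i) (by
    simp only [Finset.mem_union, Finset.mem_image, Finset.mem_range]
    exact Or.inl (Or.inr ⟨i, hi, rfl⟩))).1
  have hinv : (c 0)⁻¹ ∈ V := (hZ _ (by simp)).1
  have huV : ∀ n, u n ∈ V := by
    intro n
    induction n using Nat.strong_induction_on with
    | _ n ih =>
      rcases lt_or_ge n r with h | h
      · exact huV0 n h
      · obtain ⟨k, rfl⟩ := Nat.exists_eq_add_of_le' h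
        rw [hu]
        refine sum_mem fun i hi => ?_
        have hi' := Finset.mem_range.mp hi
        exact mul_mem (hcV i hi') (ih _ (by omega))
  let c' : ℕ → V := fun i => if h : i < r then ⟨c i, hcV i h⟩ else 0
  let u' : ℕ → V := fun n => ⟨u n, huV n⟩
  have hc' : ∀ i (h : i < r), c' i = ⟨c i, hcV i h⟩ := fun i h => by simp [c', h]
  have g1 : IsUnit (c' 0) := by
    rw [hc' 0 (by omega)]
    refine IsUnit.of_mul_eq_one ⟨_, hinv⟩ ?_
    apply Subtype.ext
    simp [hc0]
  have g2 : ∀ i < r, ∃ g : ℤ[X], g.Monic ∧ (p : V) ∣ aeval (c' i) g := by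
    intro i hi
    obtain ⟨hz, g, hg, hd⟩ := hZ (c i) (by
      simp only [Finset.mem_union, Finset.mem_image, Finset.mem_range]
      exact Or.inl (Or.inl ⟨i, hi, rfl⟩))
    exact ⟨g, hg, by rw [hc' i hi]; exact hd⟩
  have g3 : ∀ n, u' (n + r) = ∑ i ∈ Finset.range r, c' i * u' (n + i) := by
    intro n
    apply Subtype.ext
    simp only [u', AddSubmonoidClass.coe_finsetSum, MulMemClass.coe_mul]
    rw [hu]
    apply Finset.sum_congr rfl
    intro i hi
    rw [hc' i (Finset.mem_range.mp hi)]
  obtain ⟨M, hM, h⟩ := sml_rec p hp hK r hr c' u' g1 g2 g3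
  refine ⟨M, hM, fun s => ?_⟩
  have hz : ∀ n, u' n = 0 ↔ u n = 0 := fun n => by
    rw [← Subtype.coe_inj]; rfl
  simpa only [hz] using h s

/-- **Skolem–Mahler–Lech.**  The zero set of an eventually linearly recurrent complex
sequence is the union of a finite set and finitely many full arithmetic progressions;
in particular it is eventually periodic. -/
theorem stmt_3 (a : ℕ → ℂ) (ha : EventuallyLinRec a) :
    (∃ (E : Finset ℕ) (AP : Finset (ℕ × ℕ)),
      (∀ p ∈ AP, 1 ≤ p.2) ∧
      ∀ n : ℕ, a n = 0 ↔ (n ∈ E ∨ ∃ p ∈ AP, ∃ k : ℕ, n = p.1 + k * p.2)) ∧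
    (∃ M : ℕ, 1 ≤ M ∧ ∃ N : ℕ, ∀ n, N ≤ n → (a n = 0 ↔ a (n + M) = 0)) := by
  classical
  obtain ⟨r, c, N, hr, hc0, hrec⟩ := ha
  obtain ⟨M, hM, hs⟩ := sml_rec_complex (fun n => a (N + n)) r c hr hc0 (fun n => by
    have := hrec (N + n) (by omega)
    simpa [add_assoc] using this)
  have hbound : ∃ K, ∀ s < M, (∀ n, a (N + (s + M * n)) = 0) ∨
      ∀ n, K ≤ n → a (N + (s + M * n)) ≠ 0 := by
    have h1 : ∀ s, ∃ K, (∀ n, a (N + (s + M * n)) = 0) ∨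
      ∀ n, K ≤ n → a (N + (s + M * n)) ≠ 0 := by
      intro s
      rcases hs s with h | h
      · obtain ⟨K, hK⟩ := h.bddAbove
        refine ⟨K + 1, Or.inr fun n hn h0 => ?_⟩
        have := hK (show n ∈ _ from h0)
        omega
      · exact ⟨0, Or.inl h⟩
    choose K hK using h1
    refine ⟨(Finset.range M).sup K, fun s hsM => ?_⟩
    rcases hK s with h | h
    · exact Or.inl h
    · exact Or.inr fun n hn => h n (le_trans (Finset.le_sup (Finset.mem_range.mpr hsM)) hn)
  obtain ⟨K, hK⟩ := hbound
  have hdecomp : ∀ n, N ≤ n → ∃ s < M, ∃ k, n = N + (s + M * k) := by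
    intro n hn
    refine ⟨(n - N) % M, Nat.mod_lt _ hM, (n - N) / M, ?_⟩
    rw [Nat.mod_add_div]; omega
  refine ⟨⟨(Finset.range (N + M * (K + 1))).filter (fun n => a n = 0),
    ((Finset.range M).filter (fun s => ∀ n, a (N + (s + M * n)) = 0)).image (fun s => (N + s, M)),
    ?_, ?_⟩, M, hM, N + M * (K + 1), ?_⟩
  · intro q hq
    obtain ⟨s, _, rfl⟩ := Finset.mem_image.mp hq
    exact hM
  · intro n
    constructor
    · intro h0
      by_cases hn : n < N + M * (K + 1)
      · left; simp [hn, h0]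
      right
      obtain ⟨s, hsM, k, rfl⟩ := hdecomp n (by
        have : 0 ≤ M * (K + 1) := Nat.zero_le _
        omega)
      rcases hK s hsM with h | h
      · refine ⟨(N + s, M), Finset.mem_image.mpr ⟨s, by simpa [hsM] using h, rfl⟩, k, ?_⟩
        simp only; ring
      · have hKk : K ≤ k := by
          by_contra hlt
          have : M * (k + 1) ≤ M * (K + 1) := Nat.mul_le_mul_left _ (by omega)
          have : M * (k + 1) = M * k + M := by ring
          omega
        exact absurd h0 (h k hKk)
    · rintro (h | ⟨q, hq, k, rfl⟩)
      · exact (Finset.mem_filter.mp h).2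
      · obtain ⟨s, hs', rfl⟩ := Finset.mem_image.mp hq
        have := (Finset.mem_filter.mp hs').2 k
        rw [← this]; congr 1; simp only; ring
  · intro n hn
    obtain ⟨s, hsM, k, rfl⟩ := hdecomp n (by
        have : 0 ≤ M * (K + 1) := Nat.zero_le _
        omega)
    have hKk : K ≤ k := by
      by_contra hlt
      have : M * (k + 1) ≤ M * (K + 1) := Nat.mul_le_mul_left _ (by omega)
      have : M * (k + 1) = M * k + M := by ring
      omega
    have he : N + (s + M * k) + M = N + (s + M * (k + 1)) := by ring
    rw [he]
    rcases hK s hsM with h | h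
    · simp only [h]
    · exact iff_of_false (h k hKk) (h (k + 1) (by omega))
end
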